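/- There exist a sufficiently large constant σ > 0 and a constant ψ > 0 such that for all sufficiently large n and every node x of a KSWN* on n nodes, the probability that |A_x(⌈log₂ log₂ n⌉)| ≥ (log₂ n)/σ is greater than ψ, where the probability is over the random construction of the AL-links. -/

import Mathlib

open scoped Classical BigOperators ENNReal

noncomputable section

/-- Ring (Manhattan) distance on the cycle `ZMod n`:
`Dist(u,v) = min((v-u) mod n, (u-v) mod n)`. -/
def ringDist (n : ℕ) (u v : ZMod n) : ℕ := min (v - u).val (u - v).val

/-- The harmonic normalization constant `Z_u = Σ_{z ≠ u} 1 / Dist(u,z)`. -/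
def Zconst (n : ℕ) (u : ZMod n) : ℝ :=
  ∑' z : ZMod n, if z = u then 0 else ((ringDist n u z : ℝ))⁻¹

/-- Probability that the K-link of `u` points to `v`:
`Pr[u → v] = 1 / (Z_u · Dist(u,v))` for `v ≠ u`. -/
def kProb (n : ℕ) (u v : ZMod n) : ℝ :=
  if v = u then 0 else (Zconst n u * (ringDist n u v : ℝ))⁻¹

/-- The number `⌈(log₂ n)²⌉` of candidate AL-neighbours of a node. -/
def alCount (n : ℕ) : ℕ := ⌈(Real.logb 2 n) ^ 2⌉₊

/-- Probability that a single AL-link of `u` points to `v`: the link is chosen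
uniformly among the nodes `u+1, …, u+⌈(log₂ n)²⌉` (mod n). -/
def alProb (n : ℕ) (u v : ZMod n) : ℝ :=
  if ∃ i ∈ Finset.Icc 1 (alCount n), u + (i : ZMod n) = v then ((alCount n : ℝ))⁻¹ else 0

/-- A realization of all the random links of a KSWN* on `n` nodes:
for each node its K-neighbour and its two AL-neighbours. -/
structure Config (n : ℕ) where
  K : ZMod n → ZMod n
  AL : ZMod n → Fin 2 → ZMod n

/-- Probability weight of a configuration: all links are mutually independent. -/
def configProb (n : ℕ) (c : Config n) : ℝ :=
  (∏' u : ZMod n, kProb n u (c.K u)) *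
    ∏' u : ZMod n, (alProb n u (c.AL u 0) * alProb n u (c.AL u 1))

/-- Probability of an event over the random construction of the KSWN*. -/
def Pr (n : ℕ) (E : Config n → Prop) : ℝ :=
  ∑' c : Config n, if E c then configProb n c else 0

/-- The `i`-th level `T_i` of the AL-neighbourhood of `x`. -/
def levelT (n : ℕ) (c : Config n) (x : ZMod n) : ℕ → Finset (ZMod n)
  | 0 => {x}
  | i + 1 => (levelT n c x i).biUnion fun u => {c.AL u 0, c.AL u 1}

/-- The AL-awareness `A_x(k) = H_k = ∪_{j ≤ k} T_j`. -/
def aware (n : ℕ) (c : Config n) (x : ZMod n) (k : ℕ) : Finset (ZMod n) :=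
  (Finset.range (k + 1)).biUnion (levelT n c x)

/-- `⌈log₂ log₂ n⌉`, the number of awareness levels used by the algorithms. -/
def kstar (n : ℕ) : ℕ := ⌈Real.logb 2 (Real.logb 2 n)⌉₊

/-- The distance threshold `(log₂ n)² · log₂ log₂ n`. -/
def thresh (n : ℕ) : ℝ := (Real.logb 2 n) ^ 2 * Real.logb 2 (Real.logb 2 n)

/-- Immediate neighbours of `x`: its R-neighbour, K-neighbour and two AL-neighbours. -/
def neighbors (n : ℕ) (c : Config n) (x : ZMod n) : List (ZMod n) :=
  [x + 1, c.K x, c.AL x 0, c.AL x 1]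

/-- Kleinberg greedy step: forward to the immediate neighbour closest to the target `t`. -/
def greedyNext (n : ℕ) (c : Config n) (t x : ZMod n) : ZMod n :=
  ((neighbors n c x).argmin fun y => ringDist n y t).getD x

/-- Position after `k` steps of Kleinberg's greedy routing towards `t`, started at `s`. -/
def greedyTraj (n : ℕ) (c : Config n) (t s : ZMod n) (k : ℕ) : ZMod n :=
  (greedyNext n c t)^[k] s

/-- `v` is an AL-neighbour of `u`. -/
def alStep (n : ℕ) (c : Config n) (u v : ZMod n) : Prop := c.AL u 0 = v ∨ c.AL u 1 = v

/-- `p` is a path of AL-links from `y` to `z` all of whose nodes lie in `S`. -/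
def isPath (n : ℕ) (c : Config n) (S : Finset (ZMod n)) (y z : ZMod n)
    (p : List (ZMod n)) : Prop :=
  p.head? = some y ∧ p.getLast? = some z ∧ p.Chain' (alStep n c) ∧ ∀ v ∈ p, v ∈ S

/-- A shortest AL-path from `y` to `z` inside `S` (the empty list if none exists). -/
def shortestPath (n : ℕ) (c : Config n) (S : Finset (ZMod n)) (y z : ZMod n) :
    List (ZMod n) :=
  if h : ∃ p, isPath n c S y z p ∧ ∀ q, isPath n c S y z q → p.length ≤ q.length
  then h.choose else []

/-- A node `z` in `A_y(⌈log₂ log₂ n⌉)` whose K-neighbour is closest to `t`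
(ties broken by a fixed rule). -/
def chooseZ (n : ℕ) (c : Config n) (t y : ZMod n) : ZMod n :=
  (((aware n c y (kstar n)).toList.argmin fun z => ringDist n (c.K z) t).getD y)

/-- One step of Algorithm 1 (non-oblivious routing); the state is the pair
(current node, header stack). -/
def step1 (n : ℕ) (c : Config n) (t : ZMod n) :
    ZMod n × List (ZMod n) → ZMod n × List (ZMod n) := fun st =>
  if (ringDist n st.1 t : ℝ) ≥ thresh n then
    match st.2 with
    | [] =>
      let y := c.K st.1
      let z := chooseZ n c t y
      (y, (shortestPath n c (aware n c y (kstar n)) y z).tail)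
    | v :: rest => (v, rest)
  else (greedyNext n c t st.1, [])

/-- Position after `k` hops of Algorithm 1 towards `t`, started at `s` with empty stack. -/
def traj1 (n : ℕ) (c : Config n) (t s : ZMod n) (k : ℕ) : ZMod n :=
  ((step1 n c t)^[k] (s, [])).1

/-- One step of Algorithm 2 (oblivious routing) with parameter `cp`. -/
def step2 (n : ℕ) (cp : ℝ) (c : Config n) (t x : ZMod n) : ZMod n :=
  if (ringDist n x t : ℝ) ≥ cp * thresh n then
    let S := aware n c x (kstar n)
    let cands := S.filter fun z => (ringDist n (c.K z) t : ℝ) ≤ (ringDist n x t : ℝ) / 2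
    match cands.toList.argmin fun z => (shortestPath n c S x z).length with
    | none => greedyNext n c t x
    | some z =>
      if z = x then c.K x
      else
        match shortestPath n c S x z with
        | _ :: v :: _ => v
        | _ => greedyNext n c t x
  else greedyNext n c t x

/-- Position after `k` hops of Algorithm 2 (parameter `cp`) towards `t`, started at `s`. -/
def traj2 (n : ℕ) (cp : ℝ) (c : Config n) (t s : ZMod n) (k : ℕ) : ZMod n :=
  (step2 n cp c t)^[k] s

/-- The first time `k` at which `P k` holds (`⊤` if it never does). -/
def hitTime (P : ℕ → Prop) : ℕ∞ := sInf {k : ℕ∞ | ∃ m : ℕ, P m ∧ k = m}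

/-- Expected number of hops until a trajectory first reaches the goal set,
over the random construction of the network. -/
def expHit (n : ℕ) (traj : Config n → ℕ → ZMod n) (Goal : ZMod n → Prop) : ℝ≥0∞ :=
  ∑' c : Config n,
    ENNReal.ofReal (configProb n c) * ((hitTime fun m => Goal (traj c m)) : ℝ≥0∞)

/-- Direction (±1) of the shorter arc from `x` to `t`. -/
def arcDir (n : ℕ) (x t : ZMod n) : ZMod n := if (t - x).val ≤ (x - t).val then 1 else -1

/-- The point at arc-length `i` from `x` along the shorter arc towards `t`. -/
def arcPoint (n : ℕ) (x t : ZMod n) (i : ℕ) : ZMod n := x + (i : ZMod n) * arcDir n x t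

end

/-- The weight of `c` under the product of the coordinate weights `α a`. -/
def productWeight {ι V : Type*} [Fintype ι] (α : ι → V → ℝ) (c : ι → V) : ℝ := ∏ a, α a (c a)

theorem productWeight_nonneg {ι V : Type*} [Fintype ι] {α : ι → V → ℝ}
    (h0 : ∀ a v, 0 ≤ α a v) (c : ι → V) : 0 ≤ productWeight α c :=
  Finset.prod_nonneg fun a _ => h0 a (c a)

theorem productWeight_mul_update {ι V : Type*} [Fintype ι] [DecidableEq ι] (α : ι → V → ℝ)
    (a : ι) (c : ι → V) (v : V) :
    productWeight α (Function.update c a v) * α a (c a) = productWeight α c * α a v := by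
  have h : ∀ d : ι → V, productWeight α d =
      α a (d a) * ∏ b ∈ Finset.univ.erase a, α b (d b) := fun d =>
    (Finset.mul_prod_erase Finset.univ (fun b => α b (d b)) (Finset.mem_univ a)).symm
  rw [h, h c, Function.update_self]
  have : ∏ b ∈ Finset.univ.erase a, α b (Function.update c a v b) =
      ∏ b ∈ Finset.univ.erase a, α b (c b) :=
    Finset.prod_congr rfl fun b hb => by
      rw [Function.update_of_ne (Finset.ne_of_mem_erase hb)]
  rw [this]
  ring

section ProductWeight

variable {ι V : Type*} [Fintype ι] [DecidableEq ι] [Fintype V]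

theorem sum_productWeight {α : ι → V → ℝ} (h1 : ∀ a, ∑ v, α a v = 1) :
    ∑ c : ι → V, productWeight α c = 1 := by
  unfold productWeight
  rw [← Fintype.prod_sum]
  simp [h1]

/-- Resampling a single coordinate does not change expectations. -/
theorem sum_productWeight_resample {α : ι → V → ℝ} (h1 : ∀ a, ∑ v, α a v = 1) (a : ι)
    (f : (ι → V) → ℝ) :
    ∑ c, productWeight α c * f c =
      ∑ c, productWeight α c * ∑ v, α a v * f (Function.update c a v) := by
  have hl : ∑ c, productWeight α c * f c =
      ∑ p : (ι → V) × V, productWeight α p.1 * f p.1 * α a p.2 := by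
    rw [Fintype.sum_prod_type]
    refine Finset.sum_congr rfl fun c _ => ?_
    dsimp only
    rw [← Finset.mul_sum, h1, mul_one]
  have hr : ∑ c, productWeight α c * ∑ v, α a v * f (Function.update c a v) =
      ∑ p : (ι → V) × V, productWeight α p.1 * (α a p.2 * f (Function.update p.1 a p.2)) := by
    rw [Fintype.sum_prod_type]
    exact Finset.sum_congr rfl fun c _ => Finset.mul_sum _ _ _
  have hinv : Function.Involutive
      (fun p : (ι → V) × V => (Function.update p.1 a p.2, p.1 a)) := by
    rintro ⟨c, v⟩
    simp
  rw [hl, hr, ← Equiv.sum_comp hinv.toPerm]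
  refine Finset.sum_congr rfl fun p _ => ?_
  have := productWeight_mul_update α a p.1 p.2
  simp only [Function.Involutive.coe_toPerm]
  linear_combination f (Function.update p.1 a p.2) * this

/-- If the address `A` and the target `t` are insensitive, on the event `E`, to the value stored at
the address, then that value hits the target with conditional probability at most `q`. -/
theorem sum_productWeight_hit_le [DecidableEq V] {α : ι → V → ℝ} {q : ℝ} (h0 : ∀ a v, 0 ≤ α a v)
    (h1 : ∀ a, ∑ v, α a v = 1) (hq : ∀ a v, α a v ≤ q) (E : (ι → V) → Prop)
    (A : (ι → V) → ι) (t : (ι → V) → V)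
    (hE : ∀ c v, E c → E (Function.update c (A c) v))
    (hA : ∀ c v, E c → A (Function.update c (A c) v) = A c)
    (ht : ∀ c v, E c → t (Function.update c (A c) v) = t c) :
    ∑ c, productWeight α c * (if E c ∧ c (A c) = t c then 1 else 0) ≤ q := by
  have hfib : ∀ a, ∑ c, productWeight α c * (if (E c ∧ A c = a) ∧ c a = t c then 1 else 0) ≤
      ∑ c, productWeight α c * (q * if E c ∧ A c = a then 1 else 0) := by
    intro a
    rw [sum_productWeight_resample h1 a]
    refine Finset.sum_le_sum fun c _ =>
      mul_le_mul_of_nonneg_left ?_ (productWeight_nonneg h0 c)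
    by_cases hc : E c ∧ A c = a
    · obtain ⟨hc, rfl⟩ := hc
      simp [hE c _ hc, hA c _ hc, ht c _ hc, hc, hq]
    · rw [if_neg hc, mul_zero]
      refine (Finset.sum_eq_zero fun v _ => ?_).le
      rw [if_neg, mul_zero]
      rintro ⟨⟨hd, hda⟩, -⟩
      refine hc ?_
      have hback : Function.update (Function.update c a v) (A (Function.update c a v)) (c a) = c := by
        rw [hda]; simp
      have h2 := hE _ (c a) hd
      have h3 := hA _ (c a) hd
      rw [hback] at h2 h3
      exact ⟨h2, h3.trans hda⟩
  have hsum := Finset.sum_le_sum fun a (_ : a ∈ Finset.univ) => hfib a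
  have hl : ∀ c : ι → V, ∑ a, productWeight α c *
      (if (E c ∧ A c = a) ∧ c a = t c then (1 : ℝ) else 0) =
      productWeight α c * (if E c ∧ c (A c) = t c then 1 else 0) := by
    intro c
    rw [Finset.sum_eq_single (A c)]
    · simp
    · intro b _ hb
      simp [hb.symm]
    · simp
  have hr : ∀ c : ι → V, ∑ a, productWeight α c * (q * if E c ∧ A c = a then (1 : ℝ) else 0) =
      productWeight α c * (q * if E c then 1 else 0) := by
    intro c
    rw [Finset.sum_eq_single (A c)]
    · simp
    · intro b _ hb
      simp [hb.symm]
    · simp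
  rw [Finset.sum_comm.trans (Finset.sum_congr rfl fun c _ => hl c),
    Finset.sum_comm.trans (Finset.sum_congr rfl fun c _ => hr c)] at hsum
  refine hsum.trans ?_
  have htot := sum_productWeight h1
  have hq0 : 0 ≤ q := by
    rcases isEmpty_or_nonempty (ι → V) with h | ⟨⟨c⟩⟩
    · simp at htot
    · exact (h0 (A c) (t c)).trans (hq _ _)
  calc ∑ c, productWeight α c * (q * if E c then 1 else 0)
      ≤ ∑ c, productWeight α c * q := by
        refine Finset.sum_le_sum fun c _ =>
          mul_le_mul_of_nonneg_left ?_ (productWeight_nonneg h0 c)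
        split_ifs <;> simp [hq0]
    _ = q := by rw [← Finset.sum_mul, htot, one_mul]

end ProductWeight

section Exploration

variable {V : Type*}

/-- The breadth-first exploration of the binary tree of links starting at `x`:
the children of the node with index `i` have indices `2 * i + 1` and `2 * i + 2`. -/
def explore (c : V × Fin 2 → V) (x : V) : ℕ → V
  | 0 => x
  | i + 1 => c (explore c x (i / 2), Fin.ofNat 2 i)
decreasing_by omega

theorem explore_succ (c : V × Fin 2 → V) (x : V) (i : ℕ) :
    explore c x (i + 1) = c (explore c x (i / 2), Fin.ofNat 2 i) := by
  rw [explore]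

theorem explore_update [DecidableEq V] (c : V × Fin 2 → V) (x v : V) {i : ℕ}
    (hinj : Set.InjOn (explore c x) (Set.Iic i)) {l : ℕ} (hl : l ≤ i) :
    explore (Function.update c (explore c x (i / 2), Fin.ofNat 2 i) v) x l = explore c x l := by
  induction l using Nat.strong_induction_on with
  | _ l ih =>
    cases l with
    | zero => simp [explore]
    | succ l =>
      rw [explore_succ, explore_succ, ih (l / 2) (by omega) (by omega), Function.update_of_ne]
      intro h
      rw [Prod.mk.injEq, Fin.ext_iff] at h
      have h1 : l / 2 = i / 2 :=
        hinj (Set.mem_Iic.2 (by omega)) (Set.mem_Iic.2 (by omega)) h.1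
      have h2 : l % 2 = i % 2 := h.2
      omega

theorem injOn_Iic_succ_of_not_hit {f : ℕ → V} {i : ℕ} (h : Set.InjOn f (Set.Iic i))
    (hi : ∀ l ≤ i, f (i + 1) ≠ f l) : Set.InjOn f (Set.Iic (i + 1)) := by
  intro a ha b hb hab
  rw [Set.mem_Iic] at ha hb
  rcases Nat.lt_or_ge i a with ha' | ha' <;> rcases Nat.lt_or_ge i b with hb' | hb'
  · omega
  · obtain rfl : a = i + 1 := by omega
    exact absurd hab (hi b hb')
  · obtain rfl : b = i + 1 := by omega
    exact absurd hab.symm (hi a ha')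
  · exact h ha' hb' hab

theorem sum_productWeight_explore_injOn [Fintype V] [DecidableEq V] {α : V × Fin 2 → V → ℝ} {q : ℝ}
    (h0 : ∀ a v, 0 ≤ α a v) (h1 : ∀ a, ∑ v, α a v = 1) (hq : ∀ a v, α a v ≤ q) (x : V) (i : ℕ) :
    1 - (i : ℝ) ^ 2 * q ≤
      ∑ c, productWeight α c * (if Set.InjOn (explore c x) (Set.Iic i) then 1 else 0) := by
  induction i with
  | zero =>
    have : ∀ c : V × Fin 2 → V, Set.InjOn (explore c x) (Set.Iic 0) := by
      intro c a ha b hb _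
      simp at ha hb
      omega
    simp [this, sum_productWeight h1]
  | succ i ih =>
    have hq0 : 0 ≤ q := (h0 (x, 0) x).trans (hq _ _)
    have hhit : ∀ l ∈ Finset.Iic i, ∑ c, productWeight α c *
        (if Set.InjOn (explore c x) (Set.Iic i) ∧ explore c x (i + 1) = explore c x l
          then 1 else 0) ≤ q := by
      intro l hl
      rw [Finset.mem_Iic] at hl
      simp only [explore_succ]
      refine sum_productWeight_hit_le h0 h1 hq (fun c => Set.InjOn (explore c x) (Set.Iic i))
        (fun c => (explore c x (i / 2), Fin.ofNat 2 i)) (fun c => explore c x l) ?_ ?_ ?_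
      · intro c v hc
        exact hc.congr fun l hl => (explore_update c x v hc hl).symm
      · intro c v hc
        simp only [explore_update c x v hc (Nat.div_le_self i 2)]
      · intro c v hc
        exact explore_update c x v hc hl
    have hpt : ∀ c : V × Fin 2 → V,
        productWeight α c * (if Set.InjOn (explore c x) (Set.Iic i) then 1 else 0) ≤
        productWeight α c * (if Set.InjOn (explore c x) (Set.Iic (i + 1)) then 1 else 0) +
          ∑ l ∈ Finset.Iic i, productWeight α c *
            (if Set.InjOn (explore c x) (Set.Iic i) ∧ explore c x (i + 1) = explore c x l
              then 1 else 0) := by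
      intro c
      rw [← Finset.mul_sum, ← mul_add]
      refine mul_le_mul_of_nonneg_left ?_ (productWeight_nonneg h0 c)
      have hnn : ∀ l ∈ Finset.Iic i, (0 : ℝ) ≤
          if Set.InjOn (explore c x) (Set.Iic i) ∧ explore c x (i + 1) = explore c x l
            then 1 else 0 := fun l _ => by split_ifs <;> norm_num
      have hnn' := Finset.sum_nonneg hnn
      by_cases hi : Set.InjOn (explore c x) (Set.Iic i)
      · by_cases hs : Set.InjOn (explore c x) (Set.Iic (i + 1))
        · rw [if_pos hi, if_pos hs]
          linarith
        · obtain ⟨l, hl, hle⟩ : ∃ l ≤ i, explore c x (i + 1) = explore c x l := by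
            by_contra! h
            exact hs (injOn_Iic_succ_of_not_hit hi h)
          have := Finset.single_le_sum hnn (Finset.mem_Iic.2 hl)
          rw [if_pos ⟨hi, hle⟩] at this
          rw [if_pos hi, if_neg hs]
          linarith
      · rw [if_neg hi]
        refine add_nonneg ?_ hnn'
        split_ifs <;> norm_num
    have hsum := Finset.sum_le_sum fun c (_ : c ∈ Finset.univ) => hpt c
    rw [Finset.sum_add_distrib, Finset.sum_comm (s := Finset.univ) (t := Finset.Iic i)] at hsum
    have hb := Finset.sum_le_card_nsmul _ _ _ hhit
    rw [Nat.card_Iic, nsmul_eq_mul] at hb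
    push_cast at hb ⊢
    nlinarith [mul_nonneg (Nat.cast_nonneg (α := ℝ) i) hq0]

end Exploration

/-- A configuration consists of its K-links and its AL-links. -/
def configEquiv (n : ℕ) : Config n ≃ (ZMod n → ZMod n) × (ZMod n × Fin 2 → ZMod n) where
  toFun c := (c.K, fun a => c.AL a.1 a.2)
  invFun p := ⟨p.1, fun u b => p.2 (u, b)⟩
  left_inv _ := rfl
  right_inv _ := rfl

theorem configProb_configEquiv_symm (n : ℕ) [NeZero n]
    (p : (ZMod n → ZMod n) × (ZMod n × Fin 2 → ZMod n)) :
    configProb n ((configEquiv n).symm p) =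
      productWeight (kProb n) p.1 * productWeight (fun a => alProb n a.1) p.2 := by
  simp [configProb, configEquiv, productWeight, tprod_fintype, Fintype.prod_prod_type]

theorem ringDist_pos {n : ℕ} [NeZero n] {u v : ZMod n} (h : v ≠ u) : 0 < ringDist n u v := by
  have : ∀ z : ZMod n, z ≠ 0 → 0 < z.val := fun z hz =>
    Nat.pos_of_ne_zero fun h => hz ((ZMod.val_eq_zero z).1 h)
  exact lt_min (this _ (sub_ne_zero.2 h)) (this _ (sub_ne_zero.2 h.symm))

theorem sum_kProb {n : ℕ} [NeZero n] (hn : 2 ≤ n) (u : ZMod n) : ∑ v, kProb n u v = 1 := by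
  have hZ : Zconst n u = ∑ z, if z = u then 0 else ((ringDist n u z : ℝ))⁻¹ := tsum_fintype _
  have : Fact (1 < n) := ⟨hn⟩
  have hpos : 0 < Zconst n u := by
    rw [hZ]
    refine Finset.sum_pos' (fun z _ => by split_ifs <;> positivity) ⟨u + 1, Finset.mem_univ _, ?_⟩
    have h : u + 1 ≠ u := by simp
    rw [if_neg h]
    exact inv_pos.2 (Nat.cast_pos.2 (ringDist_pos h))
  have : ∀ v, kProb n u v =
      (Zconst n u)⁻¹ * if v = u then 0 else ((ringDist n u v : ℝ))⁻¹ := by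
    intro v
    unfold kProb
    split_ifs <;> simp [mul_comm]
  simp only [this]
  rw [← Finset.mul_sum, ← hZ, inv_mul_cancel₀ hpos.ne']

theorem alProb_nonneg (n : ℕ) (u v : ZMod n) : 0 ≤ alProb n u v := by
  unfold alProb
  split_ifs <;> positivity

theorem alProb_le (n : ℕ) (u v : ZMod n) : alProb n u v ≤ ((alCount n : ℝ))⁻¹ := by
  unfold alProb
  split_ifs
  · exact le_rfl
  · positivity

theorem sum_alProb {n : ℕ} [NeZero n] (hpos : 0 < alCount n) (hle : alCount n ≤ n) (u : ZMod n) :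
    ∑ v, alProb n u v = 1 := by
  have himg : ∀ v, alProb n u v =
      if v ∈ (Finset.Icc 1 (alCount n)).image fun i : ℕ => u + (i : ZMod n)
        then ((alCount n : ℝ))⁻¹ else 0 := by
    intro v
    simp only [alProb, Finset.mem_image]
    congr
  have hcard : ((Finset.Icc 1 (alCount n)).image fun i : ℕ => u + (i : ZMod n)).card =
      alCount n := by
    rw [Finset.card_image_of_injOn, Nat.card_Icc, Nat.add_sub_cancel]
    intro i hi j hj hij
    rw [Finset.mem_coe, Finset.mem_Icc] at hi hj
    have h := (ZMod.natCast_eq_natCast_iff i j n).1 (add_left_cancel hij)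
    have h' : i - 1 ≡ j - 1 [MOD n] := by
      refine Nat.ModEq.add_right_cancel' 1 ?_
      rwa [Nat.sub_add_cancel hi.1, Nat.sub_add_cancel hj.1]
    have := Nat.ModEq.eq_of_lt_of_lt h' (by omega) (by omega)
    omega
  rw [Finset.sum_congr rfl fun v _ => himg v, Finset.sum_ite_mem, Finset.univ_inter,
    Finset.sum_const, hcard, nsmul_eq_mul]
  exact mul_inv_cancel₀ (Nat.cast_ne_zero.2 hpos.ne')

/-- The probability of an event determined by the AL-links alone. -/
theorem Pr_eq_sum_productWeight {n : ℕ} [NeZero n] (hn : 2 ≤ n) (E : Config n → Prop)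
    (F : (ZMod n × Fin 2 → ZMod n) → Prop)
    (hEF : ∀ p, E ((configEquiv n).symm p) ↔ F p.2) :
    Pr n E = ∑ c, productWeight (fun a => alProb n a.1) c * (if F c then 1 else 0) := by
  unfold Pr
  rw [← (configEquiv n).symm.tsum_eq, tsum_fintype, Fintype.sum_prod_type]
  simp only [hEF, configProb_configEquiv_symm]
  have : ∀ (K : ZMod n → ZMod n) (c : ZMod n × Fin 2 → ZMod n),
      (if F c then productWeight (kProb n) K * productWeight (fun a => alProb n a.1) c else 0) =
      productWeight (kProb n) K *
        (productWeight (fun a => alProb n a.1) c * if F c then 1 else 0) := by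
    intro K c
    split_ifs <;> simp
  simp only [this]
  rw [← Finset.sum_mul_sum, sum_productWeight (sum_kProb hn), one_mul]

theorem explore_mem_levelT {n : ℕ} (c : Config n) (x : ZMod n) (k i : ℕ)
    (hlo : 2 ^ k ≤ i + 1) (hhi : i + 1 < 2 ^ (k + 1)) :
    explore (configEquiv n c).2 x i ∈ levelT n c x k := by
  induction k generalizing i with
  | zero =>
    obtain rfl : i = 0 := by omega
    simp [explore, levelT]
  | succ k ih =>
    obtain ⟨i, rfl⟩ : ∃ j, i = j + 1 :=
      ⟨i - 1, by have := Nat.one_le_two_pow (n := k); rw [pow_succ] at hlo; omega⟩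
    rw [explore_succ, levelT, Finset.mem_biUnion]
    refine ⟨_, ih (i / 2) (by rw [pow_succ] at hlo; omega) (by rw [pow_succ] at hhi; omega), ?_⟩
    generalize Fin.ofNat 2 i = b
    fin_cases b <;> simp [configEquiv]

theorem explore_mem_aware {n : ℕ} (c : Config n) (x : ZMod n) {k i : ℕ}
    (hi : i + 1 < 2 ^ (k + 1)) : explore (configEquiv n c).2 x i ∈ aware n c x k := by
  refine Finset.mem_biUnion.2 ⟨Nat.log 2 (i + 1), ?_, ?_⟩
  · rw [Finset.mem_range]
    exact Nat.log_lt_of_lt_pow (by omega) hi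
  · exact explore_mem_levelT c x _ i (Nat.pow_log_le_self 2 (by omega))
      (Nat.lt_pow_succ_log_self (by omega) _)

theorem lt_card_aware_of_injOn {n : ℕ} (c : Config n) (x : ZMod n) {k i : ℕ}
    (hi : i + 1 < 2 ^ (k + 1)) (hinj : Set.InjOn (explore (configEquiv n c).2 x) (Set.Iic i)) :
    i < (aware n c x k).card := by
  have h := Finset.card_le_card_of_injOn (s := Finset.Iic i) (t := aware n c x k)
    (explore (configEquiv n c).2 x)
    (fun l hl => explore_mem_aware c x (by have := Finset.mem_Iic.1 (Finset.mem_coe.1 hl); omega))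
    (by simpa using hinj)
  rw [Nat.card_Iic] at h
  omega

theorem eventually_alCount_le : ∀ᶠ n : ℕ in Filter.atTop, alCount n ≤ n := by
  have h : (fun t : ℝ => Real.logb 2 t ^ 2) =o[Filter.atTop] (id : ℝ → ℝ) := by
    have := (Real.isLittleO_pow_log_id_atTop (n := 2)).const_mul_left ((Real.log 2 ^ 2)⁻¹)
    refine this.congr_left fun t => ?_
    rw [Real.logb, div_pow]
    ring
  filter_upwards [tendsto_natCast_atTop_atTop.eventually (h.bound one_pos)] with n hn
  refine Nat.ceil_le.2 ?_
  simpa [abs_of_nonneg (sq_nonneg (Real.logb 2 (n : ℝ)))] using hn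

theorem le_two_pow_kstar {n : ℕ} (h : 0 < Real.logb 2 n) :
    Real.logb 2 n ≤ 2 ^ kstar n := by
  rw [← Real.rpow_natCast, ← Real.logb_le_iff_le_rpow one_lt_two h]
  exact Nat.le_ceil _

/-- There exist a (sufficiently large) constant `σ > 0` and a constant `ψ > 0`
such that for all sufficiently large `n` and every node `x`,
`Pr[ |A_x(⌈log₂ log₂ n⌉)| ≥ (log₂ n)/σ ] > ψ`. -/
theorem awareness_large_whp :
    ∃ σ ψ : ℝ, 0 < σ ∧ 0 < ψ ∧ ∃ N : ℕ, ∀ n : ℕ, N ≤ n → ∀ x : ZMod n,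
      Pr n (fun c => Real.logb 2 n / σ ≤ ((aware n c x (kstar n)).card : ℝ)) > ψ := by
  refine ⟨4, 1 / 2, by norm_num, by norm_num, Filter.eventually_atTop.1 ?_⟩
  have hlog : ∀ᶠ n : ℕ in Filter.atTop, 4 ≤ Real.logb 2 (n : ℝ) :=
    ((Real.tendsto_logb_atTop one_lt_two).comp
      tendsto_natCast_atTop_atTop).eventually_ge_atTop 4
  filter_upwards [hlog, eventually_alCount_le, Filter.eventually_ge_atTop 2] with n hL hle hn x
  have : NeZero n := ⟨by omega⟩
  set L := Real.logb 2 (n : ℝ)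
  have hm : L ^ 2 ≤ alCount n := Nat.le_ceil _
  have hm0 : (0 : ℝ) < alCount n := lt_of_lt_of_le (by positivity) hm
  have hkstar : L ≤ 2 ^ kstar n := le_two_pow_kstar (by linarith)
  set i := ⌊L / 4⌋₊
  have hi_le : (i : ℝ) ≤ L / 4 := Nat.floor_le (by linarith)
  have hi_lt : L / 4 < i + 1 := Nat.lt_floor_add_one _
  have hik : i + 1 < 2 ^ (kstar n + 1) := by
    have : ((i + 1 : ℕ) : ℝ) < ((2 ^ (kstar n + 1) : ℕ) : ℝ) := by
      push_cast
      rw [pow_succ]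
      linarith
    exact_mod_cast this
  let F : (ZMod n × Fin 2 → ZMod n) → Prop := fun d =>
    L / 4 ≤ ((aware n ((configEquiv n).symm (id, d)) x (kstar n)).card : ℝ)
  have hlevel : ∀ (p : (ZMod n → ZMod n) × (ZMod n × Fin 2 → ZMod n)),
      levelT n ((configEquiv n).symm p) x = levelT n ((configEquiv n).symm (id, p.2)) x := by
    intro p
    funext k
    induction k with
    | zero => rfl
    | succ k ih => simp only [levelT, ih]; rfl
  rw [gt_iff_lt, Pr_eq_sum_productWeight hn _ F fun p => by simp only [F, aware, hlevel p]]
  have hmain := sum_productWeight_explore_injOn (α := fun a : ZMod n × Fin 2 => alProb n a.1)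
    (fun a => alProb_nonneg n a.1) (fun a => sum_alProb (Nat.cast_pos.1 hm0) hle a.1)
    (fun a => alProb_le n a.1) x i
  have hsq : (i : ℝ) ^ 2 * ((alCount n : ℝ))⁻¹ ≤ 1 / 16 := by
    rw [← div_eq_mul_inv, div_le_iff₀ hm0]
    nlinarith [Nat.cast_nonneg (α := ℝ) i]
  refine lt_of_lt_of_le (by linarith) (hmain.trans (Finset.sum_le_sum fun d _ =>
    mul_le_mul_of_nonneg_left ?_ (productWeight_nonneg (fun a => alProb_nonneg n a.1) d)))
  by_cases hd : Set.InjOn (explore d x) (Set.Iic i)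
  · have hF : F d := by
      have h : ((i + 1 : ℕ) : ℝ) ≤ _ := Nat.cast_le.2
        (Nat.succ_le_of_lt (lt_card_aware_of_injOn ((configEquiv n).symm (id, d)) x hik hd))
      push_cast at h
      exact hi_lt.le.trans h
    rw [if_pos hd, if_pos hF]
  · rw [if_neg hd]
    split_ifs <;> norm_num
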